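/- arXiv:2007.07865 — 3 statements merged into one kernel-verified Lean document; each statement's English description precedes it below -/
import Mathlib

section
/- (Small projections on resonant zones.) For every s with 1 ≤ s ≤ d there exists a positive constant K, depending only on 𝔠, 𝔉, d, ε, τ, δ_{s−1}, C_{s−1} and D_{s−1}, such that for every submodule M of ℤ^d of dimension s and every ξ ∈ Z⁽ˢ⁾_M one has ‖(ξ+κ)_M‖ ≤ K ⟨ξ+κ⟩^{δ_{s−1} + dε}. -/
/-- A positive definite symmetric bilinear form on `ℝ^d`. -/
structure PDForm (d : ℕ) where
  B : (Fin d → ℝ) →ₗ[ℝ] (Fin d → ℝ) →ₗ[ℝ] ℝ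
  symm : ∀ x y, B x y = B y x
  posdef : ∀ x, x ≠ 0 → 0 < B x x

namespace PDForm

variable {d : ℕ} (g : PDForm d)

/-- The inner product `⟨·,·⟩` associated with the form. -/
def inn (x y : Fin d → ℝ) : ℝ := g.B x y

/-- The norm `‖·‖` associated with the form. -/
noncomputable def nrm (x : Fin d → ℝ) : ℝ := Real.sqrt (g.inn x x)

/-- The Japanese bracket `⟨x⟩ = (1+‖x‖²)^{1/2}`. -/
noncomputable def jap (x : Fin d → ℝ) : ℝ := Real.sqrt (1 + g.inn x x)

end PDForm

/-- Cast of a lattice vector of `ℤ^d` into `ℝ^d`. -/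
def zc {d : ℕ} (k : Fin d → ℤ) : Fin d → ℝ := fun i => (k i : ℝ)

/-- `𝔠 := min{‖k‖² : k ∈ ℤ^d, k ≠ 0}`. -/
noncomputable def frakc {d : ℕ} (g : PDForm d) : ℝ :=
  sInf {x | ∃ k : Fin d → ℤ, k ≠ 0 ∧ x = (g.nrm (zc k)) ^ 2}

/-- Gram volume `√det(⟨u_i,u_j⟩)` of an `s`-tuple of vectors. -/
noncomputable def gvol {d s : ℕ} (g : PDForm d) (u : Fin s → (Fin d → ℝ)) : ℝ :=
  Real.sqrt (Matrix.det (Matrix.of fun i j => g.inn (u i) (u j)))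

/-- `𝔉`, the minimal Gram volume of parallelepipeds with linearly independent integer edges. -/
noncomputable def frakC {d : ℕ} (g : PDForm d) : ℝ :=
  sInf {x | ∃ (s : ℕ) (u : Fin s → (Fin d → ℤ)), 1 ≤ s ∧ s ≤ d ∧
    LinearIndependent ℝ (fun j => zc (u j)) ∧ x = gvol g (fun j => zc (u j))}

/-- A submodule of `ℤ^d` in the sense of the paper: `span_ℝ(M) ∩ ℤ^d = M`. -/
def IsSat {d : ℕ} (M : Submodule ℤ (Fin d → ℤ)) : Prop :=
  ∀ k : Fin d → ℤ, zc k ∈ Submodule.span ℝ (zc '' (M : Set (Fin d → ℤ))) → k ∈ M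

/-- The dimension (rank) of a submodule of `ℤ^d`. -/
noncomputable def zrank {d : ℕ} (M : Submodule ℤ (Fin d → ℤ)) : ℕ := Module.finrank ℤ M

/-- `ξ_k := ξ + κ + k/2`. -/
noncomputable def xik {d : ℕ} (κ : Fin d → ℝ) (ξ k : Fin d → ℤ) : Fin d → ℝ :=
  fun i => (ξ i : ℝ) + κ i + (k i : ℝ) / 2

/-- All the data entering the definition of the resonant zones. -/
structure ZoneData (d : ℕ) where
  g : PDForm d
  κ : Fin d → ℝ
  E : Set (Fin d → ℤ)
  δ : ℝ
  ε : ℝ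
  τ : ℝ
  Cs : ℕ → ℝ
  Ds : ℕ → ℝ

namespace ZoneData

variable {d : ℕ} (Z : ZoneData d)

/-- `δ_s := δ + s (d+τ+1) ε`. -/
noncomputable def δs (s : ℕ) : ℝ := Z.δ + s * ((d + Z.τ + 1) * Z.ε)

/-- The completely nonresonant zone `Z⁽⁰⁾`. -/
noncomputable def Z0 : Set (Fin d → ℤ) :=
  {ξ | ξ ∈ Z.E ∧ ∀ k : Fin d → ℤ, k ≠ 0 →
    Z.g.nrm (zc k) ≤ (Z.g.jap (xik Z.κ ξ k)) ^ Z.ε →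
    |Z.g.inn (xik Z.κ ξ k) (zc k)| >
      (Z.g.jap (xik Z.κ ξ k)) ^ Z.δ * (Z.g.nrm (zc k)) ^ (-Z.τ)}

/-- The resonant zone `Z⁽ˢ⁾_M`, union over linearly independent `s`-tuples in `M`
of the zones `Z_{k₁,…,k_s}`. -/
noncomputable def ZM (s : ℕ) (M : Submodule ℤ (Fin d → ℤ)) : Set (Fin d → ℤ) :=
  {ξ | ξ ∈ Z.E ∧ ∃ (hs : 0 < s) (k : Fin s → (Fin d → ℤ)),
    (∀ j, k j ∈ M) ∧ LinearIndependent ℝ (fun j => zc (k j)) ∧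
    ∀ j : Fin s,
      |Z.g.inn (xik Z.κ ξ (k ⟨0, hs⟩)) (zc (k j))| ≤
        Z.Cs j * (Z.g.jap (xik Z.κ ξ (k ⟨0, hs⟩))) ^ (Z.δs j) * (Z.g.nrm (zc (k j))) ^ (-Z.τ) ∧
      Z.g.nrm (zc (k j)) ≤ Z.Ds j * (Z.g.jap (xik Z.κ ξ (k ⟨0, hs⟩))) ^ Z.ε}

/-- The resonant block `B⁽ˢ⁾_M`. -/
noncomputable def BM (s : ℕ) (M : Submodule ℤ (Fin d → ℤ)) : Set (Fin d → ℤ) :=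
  Z.ZM s M \
    ⋃ (M' : Submodule ℤ (Fin d → ℤ)) (_ : IsSat M' ∧ zrank M' = s + 1), Z.ZM (s + 1) M'

/-- The extended block `E⁽ˢ⁾_M` (for `s ≥ 1`). -/
noncomputable def EM : ℕ → Submodule ℤ (Fin d → ℤ) → Set (Fin d → ℤ)
  | s, M =>
    {ξ | (∃ b ∈ Z.BM s M, ∃ m ∈ M, ξ = b + m) ∧ ξ ∈ Z.ZM s M ∧
      ∀ r, 1 ≤ r → r < s → ∀ M' : Submodule ℤ (Fin d → ℤ),
        IsSat M' → zrank M' = r → ξ ∉ EM r M'}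
  termination_by s => s

end ZoneData

/-- Conditions on the parameters `δ, ε, τ`. -/
def ParamsOK (d : ℕ) (δ ε τ : ℝ) : Prop :=
  1 ≤ d ∧ 0 < δ ∧ δ < 1 ∧ 0 < ε ∧ (d : ℝ) - 1 < τ ∧
    δ + d * ((d + τ + 1) * ε) < 1 ∧ ε * (τ + 1) ≤ δ

/-- Conditions `1 = C₀ < C₁ < ⋯ < C_{d-1}` and `1 = D₀ < D₁ < ⋯ < D_{d-1}`. -/
def SeqOK (d : ℕ) (Cs Ds : ℕ → ℝ) : Prop :=
  Cs 0 = 1 ∧ Ds 0 = 1 ∧ (∀ j, j + 2 ≤ d → Cs j < Cs (j + 1)) ∧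
    (∀ j, j + 2 ≤ d → Ds j < Ds (j + 1))


open Matrix in
theorem Matrix.PosSemidef.one_le_det_one_add {n : Type*} [Fintype n] [DecidableEq n]
    {P : Matrix n n ℝ} (hP : P.PosSemidef) : 1 ≤ (1 + P).det := by
  have hA : (1 + P).IsHermitian := Matrix.isHermitian_one.add hP.isHermitian
  rw [hA.det_eq_prod_eigenvalues]
  refine Finset.one_le_prod fun i _ => ?_
  have hv := hA.eigenvalues_eq i
  have hn := hA.eigenvectorBasis.orthonormal.1 i
  have hsq : star (hA.eigenvectorBasis i).ofLp ⬝ᵥ (hA.eigenvectorBasis i).ofLp = (1 : ℝ) := by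
    rw [dotProduct_comm, ← EuclideanSpace.inner_eq_star_dotProduct, real_inner_self_eq_norm_sq, hn]
    norm_num
  have h0 := hP.dotProduct_mulVec_nonneg (hA.eigenvectorBasis i).ofLp
  rw [Matrix.add_mulVec, dotProduct_add, Matrix.one_mulVec, hsq] at hv
  simp only [RCLike.re_to_real] at hv
  change 1 ≤ hA.eigenvalues i
  linarith

open Matrix MatrixOrder in
theorem Matrix.PosDef.det_le_det_of_sub_posSemidef {n : Type*} [Fintype n] [DecidableEq n]
    {A B : Matrix n n ℝ} (hB : B.PosDef) (hAB : (A - B).PosSemidef) : B.det ≤ A.det := by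
  obtain ⟨S, hS⟩ := CStarAlgebra.nonneg_iff_eq_star_mul_self.mp hB.posSemidef.nonneg
  have hSdet : IsUnit S.det := by
    have h := hB.det_pos.ne'
    rw [hS, det_mul] at h
    exact (right_ne_zero_of_mul h).isUnit
  have hP := hAB.conjTranspose_mul_mul_same S⁻¹
  have hA : A = Sᴴ * (1 + (S⁻¹)ᴴ * (A - B) * S⁻¹) * S := by
    have h1 : Sᴴ * (S⁻¹)ᴴ = 1 := by
      rw [← conjTranspose_mul, nonsing_inv_mul _ hSdet, conjTranspose_one]
    have h2 : S⁻¹ * S = 1 := nonsing_inv_mul _ hSdet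
    calc A = Sᴴ * S + (A - B) := by
          rw [← star_eq_conjTranspose, ← hS]; abel
      _ = Sᴴ * S + (Sᴴ * (S⁻¹)ᴴ) * (A - B) * (S⁻¹ * S) := by rw [h1, h2]; simp
      _ = _ := by noncomm_ring
  have hB' : B.det = Sᴴ.det * S.det := by rw [hS, det_mul, star_eq_conjTranspose]
  calc B.det = B.det * 1 := (mul_one _).symm
    _ ≤ B.det * (1 + (S⁻¹)ᴴ * (A - B) * S⁻¹).det :=
        mul_le_mul_of_nonneg_left hP.one_le_det_one_add hB.det_pos.le
    _ = A.det := by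
        conv_rhs => rw [hA]
        rw [det_mul, det_mul, hB']; ring

open Matrix in
theorem Matrix.abs_adjugate_le {n : Type*} [Fintype n] [DecidableEq n] {A : Matrix n n ℝ} {r : ℝ}
    (hr : 0 < r) (hA : ∀ i j, |A i j| ≤ r) (i j : n) :
    |A.adjugate i j| ≤ (Fintype.card n).factorial * r ^ (Fintype.card n - 1) := by
  have hscale : A = r • (r⁻¹ • A) := by rw [smul_smul, mul_inv_cancel₀ hr.ne', one_smul]
  have hdet : |(r⁻¹ • A).adjugate i j| ≤ (Fintype.card n).factorial := by
    rw [adjugate_apply]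
    have := det_le (A := (r⁻¹ • A).updateRow j (Pi.single i 1)) (abv := AbsoluteValue.abs) (x := 1)
      (fun a b => by
        rw [AbsoluteValue.abs_apply, updateRow_apply]
        split_ifs
        · by_cases h : b = i
          · subst h; simp
          · simp [h]
        · rw [smul_apply, smul_eq_mul, abs_mul, abs_of_pos (inv_pos.2 hr), inv_mul_le_iff₀ hr,
            mul_one]
          exact hA a b)
    simpa using this
  rw [hscale, adjugate_smul, smul_apply, smul_eq_mul, abs_mul, abs_of_pos (pow_pos hr _), mul_comm]
  exact mul_le_mul_of_nonneg_right hdet (pow_nonneg hr.le _)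

namespace PDForm

variable {d : ℕ} (g : PDForm d)

/-- The Gram matrix of a tuple of vectors. -/
def gram {ι : Type*} (u : ι → Fin d → ℝ) : Matrix ι ι ℝ := Matrix.of fun i j => g.inn (u i) (u j)

theorem inn_comm (x y : Fin d → ℝ) : g.inn x y = g.inn y x := g.symm x y

theorem inn_add_left (x y z : Fin d → ℝ) : g.inn (x + y) z = g.inn x z + g.inn y z := by
  simp [inn]

theorem inn_add_right (x y z : Fin d → ℝ) : g.inn x (y + z) = g.inn x y + g.inn x z := by
  simp [inn]

theorem inn_smul_left (c : ℝ) (x y : Fin d → ℝ) : g.inn (c • x) y = c * g.inn x y := by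
  simp [inn]

theorem inn_smul_right (c : ℝ) (x y : Fin d → ℝ) : g.inn x (c • y) = c * g.inn x y := by
  simp [inn]

theorem inn_sum_left {ι : Type*} (s : Finset ι) (f : ι → Fin d → ℝ) (x : Fin d → ℝ) :
    g.inn (∑ i ∈ s, f i) x = ∑ i ∈ s, g.inn (f i) x := by
  simp [inn]

theorem inn_sum_right {ι : Type*} (s : Finset ι) (f : ι → Fin d → ℝ) (x : Fin d → ℝ) :
    g.inn x (∑ i ∈ s, f i) = ∑ i ∈ s, g.inn x (f i) := by
  simp [inn]

theorem inn_self_nonneg (x : Fin d → ℝ) : 0 ≤ g.inn x x := by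
  rcases eq_or_ne x 0 with rfl | hx
  · simp [inn]
  · exact (g.posdef x hx).le

theorem nrm_nonneg (x : Fin d → ℝ) : 0 ≤ g.nrm x := Real.sqrt_nonneg _

theorem nrm_sq (x : Fin d → ℝ) : g.nrm x ^ 2 = g.inn x x := Real.sq_sqrt (g.inn_self_nonneg x)

theorem jap_sq (x : Fin d → ℝ) : g.jap x ^ 2 = 1 + g.inn x x :=
  Real.sq_sqrt (by linarith [g.inn_self_nonneg x])

theorem one_le_jap (x : Fin d → ℝ) : 1 ≤ g.jap x :=
  Real.one_le_sqrt.2 (by linarith [g.inn_self_nonneg x])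

/-- The Cauchy–Schwarz inequality. -/
theorem abs_inn_le (x y : Fin d → ℝ) : |g.inn x y| ≤ g.nrm x * g.nrm y := by
  refine abs_le_of_sq_le_sq ?_ (mul_nonneg (g.nrm_nonneg _) (g.nrm_nonneg _))
  rw [mul_pow, nrm_sq, nrm_sq]
  have h := discrim_le_zero (a := g.inn y y) (b := 2 * g.inn x y) (c := g.inn x x) fun t => by
    have := g.inn_self_nonneg (x + t • y)
    simp only [inn_add_left, inn_add_right, inn_smul_left, inn_smul_right, g.inn_comm y x] at this
    linarith
  rw [discrim] at h
  linarith

theorem jap_add_le (x y : Fin d → ℝ) : g.jap (x + y) ≤ g.jap x + g.nrm y := by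
  have h0 : 0 ≤ g.jap x + g.nrm y :=
    add_nonneg (zero_le_one.trans (g.one_le_jap x)) (g.nrm_nonneg y)
  refine (abs_le_of_sq_le_sq' ?_ h0).2
  have hxy := (le_abs_self _).trans (g.abs_inn_le x y)
  have hx : g.nrm x ≤ g.jap x := Real.sqrt_le_sqrt (by linarith)
  have := mul_le_mul_of_nonneg_right hx (g.nrm_nonneg y)
  rw [add_sq, jap_sq, jap_sq, nrm_sq, inn_add_left, inn_add_right, inn_add_right, g.inn_comm y x]
  linarith

open Matrix in
theorem gram_mulVec {ι : Type*} [Fintype ι] (u : ι → Fin d → ℝ) (a : ι → ℝ) (i : ι) :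
    (g.gram u *ᵥ a) i = g.inn (∑ j, a j • u j) (u i) := by
  simp only [gram, mulVec, dotProduct, of_apply, inn_sum_left, inn_smul_left]
  exact Finset.sum_congr rfl fun j _ => by rw [g.inn_comm, mul_comm]

open Matrix in
theorem dotProduct_gram_mulVec {ι : Type*} [Fintype ι] (u : ι → Fin d → ℝ) (a : ι → ℝ) :
    a ⬝ᵥ (g.gram u *ᵥ a) = g.inn (∑ j, a j • u j) (∑ j, a j • u j) := by
  rw [inn_sum_right, dotProduct]
  exact Finset.sum_congr rfl fun j _ => by rw [gram_mulVec, inn_smul_right]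

theorem gram_isHermitian {ι : Type*} (u : ι → Fin d → ℝ) : (g.gram u).IsHermitian := by
  ext i j
  simp [gram, g.inn_comm]

theorem gram_posDef {ι : Type*} [Fintype ι] {u : ι → Fin d → ℝ} (hu : LinearIndependent ℝ u) :
    (g.gram u).PosDef := by
  refine Matrix.PosDef.of_dotProduct_mulVec_pos (g.gram_isHermitian u) fun x hx => ?_
  rw [star_trivial, dotProduct_gram_mulVec]
  refine g.posdef _ fun h => hx ?_
  exact funext (Fintype.linearIndependent_iff.1 hu x h)

/-- The standard dot product. -/
def dot (d : ℕ) : PDForm d where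
  B := dotProductBilin ℝ ℝ
  symm x y := by simp [dotProduct_comm]
  posdef x hx := by
    have h : 0 ≤ dotProduct x x := Finset.sum_nonneg fun i _ => mul_self_nonneg (x i)
    exact h.lt_of_ne fun h0 => hx (dotProduct_self_eq_zero.1 h0.symm)

theorem dot_inn (x y : Fin d → ℝ) : (dot d).inn x y = ∑ i, x i * y i := rfl

theorem continuous_inn_self : Continuous fun x => g.inn x x := by
  have h : ∀ x : Fin d → ℝ, g.inn x x =
      dotProduct x (Matrix.mulVec (g.gram fun i => Pi.single i (1 : ℝ)) x) := fun x => by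
    rw [dotProduct_gram_mulVec, ← pi_eq_sum_univ' x]
  simp_rw [h]
  fun_prop

theorem exists_pos_mul_dot_le : ∃ l : ℝ, 0 < l ∧ l ≤ 1 ∧
    ∀ x, l * (dot d).inn x x ≤ g.inn x x := by
  obtain ⟨m, hm0, hm⟩ := (isCompact_sphere (0 : Fin d → ℝ) 1).exists_forall_le'
    g.continuous_inn_self.continuousOn (a := 0) fun x hx =>
      g.posdef x (ne_zero_of_mem_unit_sphere ⟨x, hx⟩)
  have hd : (0 : ℝ) < d + 1 := by positivity
  have key : ∀ x, m / (d + 1) * (dot d).inn x x ≤ g.inn x x := fun x => by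
    rcases eq_or_ne x 0 with rfl | hx
    · simp [inn]
    have hx' : 0 < ‖x‖ := norm_pos_iff.2 hx
    have h1 := hm (‖x‖⁻¹ • x) (by simp [norm_smul, hx'.ne'])
    rw [inn_smul_left, inn_smul_right] at h1
    have h2 : m * ‖x‖ ^ 2 ≤ g.inn x x := by
      calc m * ‖x‖ ^ 2 ≤ ‖x‖⁻¹ * (‖x‖⁻¹ * g.inn x x) * ‖x‖ ^ 2 := by gcongr
        _ = g.inn x x := by field_simp
    have h3 : (dot d).inn x x ≤ (d + 1) * ‖x‖ ^ 2 := by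
      calc (dot d).inn x x = ∑ i, x i * x i := rfl
        _ ≤ ∑ _i : Fin d, ‖x‖ ^ 2 := Finset.sum_le_sum fun i _ => by
            have := norm_le_pi_norm x i
            rw [Real.norm_eq_abs] at this
            rw [← sq, ← sq_abs]; gcongr
        _ = d * ‖x‖ ^ 2 := by simp
        _ ≤ _ := by nlinarith [sq_nonneg ‖x‖]
    calc m / (d + 1) * (dot d).inn x x ≤ m / (d + 1) * ((d + 1) * ‖x‖ ^ 2) := by gcongr
      _ = m * ‖x‖ ^ 2 := by field_simp
      _ ≤ _ := h2
  refine ⟨min (m / (d + 1)) 1, by positivity, min_le_right _ _, fun x => ?_⟩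
  exact (mul_le_mul_of_nonneg_right (min_le_left _ _) ((dot d).inn_self_nonneg x)).trans (key x)

theorem _root_.zc_ne_zero {k : Fin d → ℤ} (hk : k ≠ 0) : zc k ≠ 0 := fun h =>
  hk (funext fun i => by simpa [zc] using congrFun h i)

theorem one_le_det_gram_dot {s : ℕ} {u : Fin s → Fin d → ℤ}
    (hu : LinearIndependent ℝ fun j => zc (u j)) :
    1 ≤ ((dot d).gram fun j => zc (u j)).det := by
  have hpos := ((dot d).gram_posDef hu).det_pos
  have hcast : ((dot d).gram fun j => zc (u j)) =
      (Matrix.of fun i j => ∑ l, u i l * u j l).map (Int.castRingHom ℝ) := by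
    ext i j
    simp [gram, dot_inn, zc]
  rw [hcast, ← RingHom.mapMatrix_apply, ← RingHom.map_det] at hpos ⊢
  simp only [eq_intCast] at hpos ⊢
  exact_mod_cast Int.cast_pos.1 hpos

theorem exists_pos_le_det_gram : ∃ l : ℝ, 0 < l ∧ ∀ (s : ℕ) (u : Fin s → Fin d → ℤ), s ≤ d →
    LinearIndependent ℝ (fun j => zc (u j)) → l ≤ (g.gram fun j => zc (u j)).det := by
  obtain ⟨l, hl0, hl1, hl⟩ := g.exists_pos_mul_dot_le
  refine ⟨l ^ d, by positivity, fun s u hs hu => ?_⟩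
  have hB : (l • (dot d).gram fun j => zc (u j)).PosDef := ((dot d).gram_posDef hu).smul hl0
  have hAB := hB.det_le_det_of_sub_posSemidef (A := g.gram fun j => zc (u j)) <|
    Matrix.PosSemidef.of_dotProduct_mulVec_nonneg ((g.gram_isHermitian _).sub hB.isHermitian)
      fun x => by
        rw [star_trivial, Matrix.sub_mulVec, dotProduct_sub, Matrix.smul_mulVec, dotProduct_smul,
          dotProduct_gram_mulVec, dotProduct_gram_mulVec, smul_eq_mul, sub_nonneg]
        exact hl _
  rw [Matrix.det_smul, Fintype.card_fin] at hAB
  calc l ^ d ≤ l ^ s * 1 := by rw [mul_one]; exact pow_le_pow_of_le_one hl0.le hl1 hs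
    _ ≤ _ := mul_le_mul_of_nonneg_left (one_le_det_gram_dot hu) (by positivity)
    _ ≤ _ := hAB

theorem frakc_pos (hd : 1 ≤ d) : 0 < frakc g := by
  obtain ⟨l, hl0, -, hl⟩ := g.exists_pos_mul_dot_le
  refine hl0.trans_le (le_csInf ?_ ?_)
  · exact ⟨_, fun _ => 1, fun h => by simpa using congrFun h ⟨0, hd⟩, rfl⟩
  · rintro _ ⟨k, hk, rfl⟩
    rw [nrm_sq]
    refine le_trans ?_ (hl _)
    have hpos := (dot d).posdef _ (zc_ne_zero hk)
    have hcast : (dot d).inn (zc k) (zc k) = ((∑ i, k i * k i : ℤ) : ℝ) := by simp [dot_inn, zc]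
    change 0 < (dot d).inn _ _ at hpos
    rw [hcast] at hpos ⊢
    have : (1 : ℝ) ≤ ((∑ i, k i * k i : ℤ) : ℝ) := by exact_mod_cast Int.cast_pos.1 hpos
    nlinarith

theorem sqrt_frakc_le_nrm {k : Fin d → ℤ} (hk : k ≠ 0) : √(frakc g) ≤ g.nrm (zc k) := by
  refine Real.sqrt_le_iff.2 ⟨g.nrm_nonneg _, csInf_le ⟨0, ?_⟩ ⟨k, hk, rfl⟩⟩
  rintro _ ⟨m, -, rfl⟩
  positivity

theorem frakC_pos (hd : 1 ≤ d) : 0 < frakC g := by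
  obtain ⟨l, hl0, hl⟩ := g.exists_pos_le_det_gram
  refine (Real.sqrt_pos.2 hl0).trans_le (le_csInf ?_ ?_)
  · refine ⟨_, 1, fun _ _ => 1, le_rfl, hd, ?_, rfl⟩
    exact LinearIndependent.of_subsingleton 0 (zc_ne_zero fun h => by simpa using congrFun h ⟨0, hd⟩)
  · rintro _ ⟨s, u, -, hs, hu, rfl⟩
    exact Real.sqrt_le_sqrt (hl s u hs hu)

theorem frakC_sq_le_det_gram (hd : 1 ≤ d) {s : ℕ} (hs1 : 1 ≤ s) (hs : s ≤ d)
    {u : Fin s → Fin d → ℤ} (hu : LinearIndependent ℝ fun j => zc (u j)) :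
    frakC g ^ 2 ≤ (g.gram fun j => zc (u j)).det := by
  have h : frakC g ≤ √(g.gram fun j => zc (u j)).det := by
    refine csInf_le ⟨0, ?_⟩ ⟨s, u, hs1, hs, hu, rfl⟩
    rintro _ ⟨s, u, -, -, -, rfl⟩
    exact Real.sqrt_nonneg _
  exact (Real.le_sqrt' (g.frakC_pos hd)).1 h

open Matrix in
/-- A vector of the span of `u` is controlled by its products with the vectors `u i`. -/
theorem det_gram_mul_inn_le {s : ℕ} (u : Fin s → Fin d → ℝ) {p : Fin d → ℝ}
    (hp : p ∈ Submodule.span ℝ (Set.range u)) {r β : ℝ} (hr : 0 < r)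
    (hu : ∀ j, g.nrm (u j) ≤ r) (hβ : ∀ j, |g.inn p (u j)| ≤ β) :
    (g.gram u).det * g.inn p p ≤ s ^ 2 * s.factorial * (β * r ^ (s - 1)) ^ 2 := by
  obtain ⟨a, rfl⟩ := (Submodule.mem_span_range_iff_exists_fun ℝ).1 hp
  set b := g.gram u *ᵥ a with hb
  have hbβ : ∀ j, |b j| ≤ β := fun j => by rw [hb, gram_mulVec]; exact hβ j
  have hadj : ∀ i j, |(g.gram u).adjugate i j| ≤ s.factorial * (r ^ 2) ^ (s - 1) := fun i j => by
    have := abs_adjugate_le (A := g.gram u) (pow_pos hr 2) (fun i j => by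
      refine (g.abs_inn_le _ _).trans ?_
      rw [sq]
      exact mul_le_mul (hu i) (hu j) (g.nrm_nonneg _) hr.le) i j
    simpa using this
  have hdet : (g.gram u).det * g.inn (∑ j, a j • u j) (∑ j, a j • u j) =
      b ⬝ᵥ ((g.gram u).adjugate *ᵥ b) := by
    rw [hb, mulVec_mulVec, adjugate_mul, smul_mulVec, one_mulVec, dotProduct_smul, smul_eq_mul,
      dotProduct_comm, dotProduct_gram_mulVec]
  rw [hdet]
  calc b ⬝ᵥ ((g.gram u).adjugate *ᵥ b)
      = ∑ i, ∑ j, b i * ((g.gram u).adjugate i j * b j) := by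
        simp only [dotProduct, mulVec, Finset.mul_sum]
    _ ≤ ∑ _i : Fin s, ∑ _j : Fin s, β * (s.factorial * (r ^ 2) ^ (s - 1) * β) := by
        refine Finset.sum_le_sum fun i _ => Finset.sum_le_sum fun j _ => ?_
        have hβ0 : 0 ≤ β := (abs_nonneg _).trans (hbβ i)
        refine (le_abs_self _).trans ?_
        rw [abs_mul, abs_mul]
        gcongr
        exacts [hbβ i, hadj i j, hbβ j]
    _ = _ := by
        simp only [Finset.sum_const, Finset.card_univ, Fintype.card_fin, nsmul_eq_mul]
        ring

end PDForm

theorem span_zc_image_le_span_range {d s : ℕ} {M : Submodule ℤ (Fin d → ℤ)} (hM : zrank M = s)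
    {k : Fin s → Fin d → ℤ} (hkM : ∀ j, k j ∈ M) (hk : LinearIndependent ℝ fun j => zc (k j)) :
    Submodule.span ℝ (zc '' (M : Set (Fin d → ℤ))) ≤
      Submodule.span ℝ (Set.range fun j => zc (k j)) := by
  let b := Module.finBasis ℤ M
  have hle : Submodule.span ℝ (zc '' (M : Set (Fin d → ℤ))) ≤
      Submodule.span ℝ (Set.range fun i => zc (b i : Fin d → ℤ)) := by
    rw [Submodule.span_le]
    rintro _ ⟨m, hm, rfl⟩
    obtain ⟨c, hc⟩ : ∃ c : _ → ℤ, ∑ i, c i • b i = ⟨m, hm⟩ := ⟨_, b.sum_repr ⟨m, hm⟩⟩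
    have hsum : zc m = ∑ i, (c i : ℝ) • zc (b i : Fin d → ℤ) := by
      funext l
      have hl := congrArg (Int.cast : ℤ → ℝ) (congrFun (congrArg Subtype.val hc) l)
      simpa [zc, Finset.sum_apply] using hl.symm
    rw [hsum]
    exact Submodule.sum_mem _ fun i _ =>
      Submodule.smul_mem _ _ (Submodule.subset_span (Set.mem_range_self i))
  have hrank : Module.finrank ℝ (Submodule.span ℝ (zc '' (M : Set (Fin d → ℤ)))) ≤ s := by
    refine (Submodule.finrank_mono hle).trans ((finrank_range_le_card _).trans ?_)
    rw [Fintype.card_fin]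
    exact hM.le
  refine (Submodule.eq_of_le_of_finrank_le (Submodule.span_mono ?_) ?_).ge
  · rintro _ ⟨j, rfl⟩
    exact ⟨k j, hkM j, rfl⟩
  · rwa [finrank_span_eq_card hk, Fintype.card_fin]

theorem monotone_of_lt_succ_of_le {d : ℕ} {f : ℕ → ℝ} (hf : ∀ j, j + 2 ≤ d → f j < f (j + 1))
    {i j : ℕ} (hij : i ≤ j) (hj : j < d) : f i ≤ f j := by
  induction j, hij using Nat.le_induction with
  | base => exact le_rfl
  | succ j _ ih => exact (ih (by omega)).trans (hf j (by omega)).le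

/-- If `x` differs from `y` by at most `x ^ ε / 2`, then `x` and `y` are comparable. -/
theorem le_two_mul_of_le_add_rpow {x y ε : ℝ} (hx : 1 ≤ x) (hε : ε ≤ 1)
    (h : x ≤ y + x ^ ε / 2) : x ≤ 2 * y := by
  have := Real.rpow_le_rpow_of_exponent_le hx hε
  rw [Real.rpow_one] at this
  linarith

theorem rpow_add_rpow_mul_pow_le {x σ ε c D : ℝ} {s d : ℕ} (hx : 1 ≤ x) (hc : 0 ≤ c) (hD : 0 ≤ D)
    (hε : 0 ≤ ε) (hεσ : ε ≤ σ) (hs : 1 ≤ s) (hsd : s ≤ d) :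
    (c * x ^ σ + x ^ ε * (D * x ^ ε) / 2) * (D * x ^ ε) ^ (s - 1) ≤
      (c + D / 2) * D ^ (s - 1) * x ^ (σ + d * ε) := by
  have hx0 : 0 < x := one_pos.trans_le hx
  have hpow : (x ^ ε) ^ (s - 1) = x ^ (ε * ((s : ℝ) - 1)) := by
    rw [← Real.rpow_natCast, ← Real.rpow_mul hx0.le, Nat.cast_sub hs, Nat.cast_one]
  have hsd' : (s : ℝ) * ε ≤ d * ε := mul_le_mul_of_nonneg_right (Nat.cast_le.2 hsd) hε
  have h1 : x ^ σ * (x ^ ε) ^ (s - 1) ≤ x ^ (σ + d * ε) := by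
    rw [hpow, ← Real.rpow_add hx0]
    exact Real.rpow_le_rpow_of_exponent_le hx (by linarith)
  have h2 : x ^ ε * x ^ ε * (x ^ ε) ^ (s - 1) ≤ x ^ (σ + d * ε) := by
    rw [hpow, ← Real.rpow_add hx0, ← Real.rpow_add hx0]
    exact Real.rpow_le_rpow_of_exponent_le hx (by linarith)
  calc (c * x ^ σ + x ^ ε * (D * x ^ ε) / 2) * (D * x ^ ε) ^ (s - 1)
      = c * D ^ (s - 1) * (x ^ σ * (x ^ ε) ^ (s - 1)) +
          D / 2 * D ^ (s - 1) * (x ^ ε * x ^ ε * (x ^ ε) ^ (s - 1)) := by rw [mul_pow]; ring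
    _ ≤ c * D ^ (s - 1) * x ^ (σ + d * ε) + D / 2 * D ^ (s - 1) * x ^ (σ + d * ε) := by gcongr
    _ = _ := by ring

theorem PDForm.frakC_mul_nrm_le {d : ℕ} (g : PDForm d) (hd : 1 ≤ d) {s : ℕ} (hs1 : 1 ≤ s)
    (hsd : s ≤ d) {k : Fin s → Fin d → ℤ} (hk : LinearIndependent ℝ fun j => zc (k j))
    {p : Fin d → ℝ} (hp : p ∈ Submodule.span ℝ (Set.range fun j => zc (k j))) {r β : ℝ}
    (hr : 0 < r) (hβ0 : 0 ≤ β) (hkr : ∀ j, g.nrm (zc (k j)) ≤ r)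
    (hβ : ∀ j, |g.inn p (zc (k j))| ≤ β) :
    frakC g * g.nrm p ≤ s * s.factorial * (β * r ^ (s - 1)) := by
  refine (abs_le_of_sq_le_sq' ?_ (by positivity)).2
  have hfac : (1 : ℝ) ≤ s.factorial := by exact_mod_cast s.factorial_pos
  calc (frakC g * g.nrm p) ^ 2 = frakC g ^ 2 * g.inn p p := by rw [mul_pow, nrm_sq]
    _ ≤ (g.gram fun j => zc (k j)).det * g.inn p p :=
        mul_le_mul_of_nonneg_right (g.frakC_sq_le_det_gram hd hs1 hsd hk) (g.inn_self_nonneg p)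
    _ ≤ s ^ 2 * s.factorial * (β * r ^ (s - 1)) ^ 2 := g.det_gram_mul_inn_le _ hp hr hkr hβ
    _ ≤ s ^ 2 * s.factorial ^ 2 * (β * r ^ (s - 1)) ^ 2 := by
        gcongr
        exact le_self_pow₀ hfac two_ne_zero
    _ = _ := by ring

/-- small projections on resonant zones. For every `1 ≤ s ≤ d` there is
`K > 0`, depending only on `𝔠, 𝔉, d, ε, τ, δ_{s-1}, C_{s-1}, D_{s-1}`, such that for every
submodule `M` of dimension `s` and every `ξ ∈ Z⁽ˢ⁾_M` one has
`‖(ξ+κ)_M‖ ≤ K ⟨ξ+κ⟩^{δ_{s-1}+dε}`. -/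
theorem statement7 (d s : ℕ) (δ ε τ : ℝ) (hpar : ParamsOK d δ ε τ)
    (hs1 : 1 ≤ s) (hsd : s ≤ d) :
    ∃ K : ℝ → ℝ → ℝ → ℝ → ℝ,
      (∀ a b c e, 0 < K a b c e) ∧
      ∀ (g : PDForm d) (κ : Fin d → ℝ) (E : Set (Fin d → ℤ)) (Cs Ds : ℕ → ℝ),
        SeqOK d Cs Ds →
        let Z : ZoneData d := ⟨g, κ, E, δ, ε, τ, Cs, Ds⟩
        ∀ (M : Submodule ℤ (Fin d → ℤ)), IsSat M → zrank M = s →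
          ∀ ξ ∈ Z.ZM s M, ∀ p q : Fin d → ℝ,
            p ∈ Submodule.span ℝ (zc '' (M : Set (Fin d → ℤ))) →
            (∀ m ∈ M, g.inn q (zc m) = 0) →
            zc ξ + κ = p + q →
            g.nrm p ≤ K (frakc g) (frakC g) (Cs (s - 1)) (Ds (s - 1)) *
              (g.jap (zc ξ + κ)) ^ (δ + ((s : ℝ) - 1) * ((d + τ + 1) * ε) + d * ε) := by
  obtain ⟨hd, hδ0, -, hε0, hτ, hδ1, hετ⟩ := hpar
  have hd' : (1 : ℝ) ≤ d := by exact_mod_cast hd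
  have hs' : (1 : ℝ) ≤ s := by exact_mod_cast hs1
  have hτ0 : 0 < τ := by linarith
  have hεδ : ε ≤ δ := by nlinarith
  have hstep : 0 ≤ (d + τ + 1) * ε := by positivity
  have hε1 : ε ≤ 1 := by nlinarith
  set σ := δ + ((s : ℝ) - 1) * ((d + τ + 1) * ε) with hσ
  have hδσ : δ ≤ σ := by
    have := mul_nonneg (sub_nonneg.2 hs') hstep
    linarith
  set θ := σ + d * ε with hθ
  have hθ0 : 0 ≤ θ := by positivity
  refine ⟨fun a b c e => max 1 (2 ^ θ * (s * s.factorial *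
    ((c * √a ^ (-τ) + e / 2) * e ^ (s - 1)) / b)), fun a b c e => by positivity, ?_⟩
  intro g κ E Cs Ds hseq Z M _ hMs ξ hξ p q hp hq hpq
  obtain ⟨hC0, hD0, hCs, hDs⟩ := hseq
  obtain ⟨-, hs, k, hkM, hk, hres⟩ := hξ
  have hC1 : 1 ≤ Cs (s - 1) := hC0 ▸ monotone_of_lt_succ_of_le hCs (Nat.zero_le _) (by omega)
  have hD1 : 1 ≤ Ds (s - 1) := hD0 ▸ monotone_of_lt_succ_of_le hDs (Nat.zero_le _) (by omega)
  set C := Cs (s - 1)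
  set D := Ds (s - 1)
  have hc := g.frakc_pos hd
  have hF := g.frakC_pos hd
  set k₀ := k ⟨0, hs⟩
  have hxik : xik κ ξ k₀ = (zc ξ + κ) + (1 / 2 : ℝ) • zc k₀ := by
    funext i
    simp [xik, zc]
    ring
  set x := g.jap (xik κ ξ k₀)
  set y := g.jap (zc ξ + κ)
  have hx : 1 ≤ x := g.one_le_jap _
  have hx0 : 0 < x := one_pos.trans_le hx
  have hy : 1 ≤ y := g.one_le_jap _
  have hk₀ : g.nrm (zc k₀) ≤ x ^ ε := by simpa [Z, hD0] using (hres ⟨0, hs⟩).2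
  have hhalf : g.nrm ((1 / 2 : ℝ) • zc k₀) = g.nrm (zc k₀) / 2 := by
    rw [PDForm.nrm, g.inn_smul_left, g.inn_smul_right, ← g.nrm_sq, ← mul_assoc,
      show (1 / 2 : ℝ) * (1 / 2) * g.nrm (zc k₀) ^ 2 = (g.nrm (zc k₀) / 2) ^ 2 by ring,
      Real.sqrt_sq (div_nonneg (g.nrm_nonneg _) zero_le_two)]
  have hxy : x ≤ 2 * y := by
    refine le_two_mul_of_le_add_rpow hx hε1 ?_
    have h := g.jap_add_le (zc ξ + κ) ((1 / 2 : ℝ) • zc k₀)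
    rw [← hxik, hhalf] at h
    exact h.trans (by gcongr)
  have hkr : ∀ j, g.nrm (zc (k j)) ≤ D * x ^ ε := fun j => by
    refine (hres j).2.trans (mul_le_mul_of_nonneg_right ?_ (by positivity))
    exact monotone_of_lt_succ_of_le hDs (by omega) (by omega)
  have hinn : ∀ j, |g.inn (xik κ ξ k₀) (zc (k j))| ≤ C * √(frakc g) ^ (-τ) * x ^ σ := fun j => by
    have hCj : Cs j ≤ C := monotone_of_lt_succ_of_le hCs (by omega) (by omega)
    have hkj : k j ≠ 0 := fun h => hk.ne_zero j (by rw [h]; funext i; simp [zc])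
    have hδj : Z.δs j ≤ σ := by
      have hj : ((j : ℕ) : ℝ) ≤ s - 1 := by
        have : ((j : ℕ) : ℝ) + 1 ≤ s := by exact_mod_cast j.2
        linarith
      have := mul_le_mul_of_nonneg_right hj hstep
      change δ + (j : ℕ) * ((d + τ + 1) * ε) ≤ σ
      linarith
    have hnorm : g.nrm (zc (k j)) ^ (-τ) ≤ √(frakc g) ^ (-τ) :=
      Real.rpow_le_rpow_of_nonpos (Real.sqrt_pos.2 hc) (g.sqrt_frakc_le_nrm hkj) (by linarith)
    calc _ ≤ Cs j * x ^ Z.δs j * g.nrm (zc (k j)) ^ (-τ) := (hres j).1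
      _ ≤ C * x ^ σ * √(frakc g) ^ (-τ) := by
          gcongr
          exact Real.rpow_nonneg (g.nrm_nonneg _) _
      _ = _ := by ring
  have hβ : ∀ j, |g.inn p (zc (k j))| ≤
      C * √(frakc g) ^ (-τ) * x ^ σ + x ^ ε * (D * x ^ ε) / 2 := fun j => by
    have hsplit : g.inn p (zc (k j)) =
        g.inn (xik κ ξ k₀) (zc (k j)) - g.inn (zc k₀) (zc (k j)) / 2 := by
      rw [hxik, hpq, g.inn_add_left, g.inn_add_left, g.inn_smul_left, hq _ (hkM j)]
      ring
    have hcs : |g.inn (zc k₀) (zc (k j))| ≤ x ^ ε * (D * x ^ ε) :=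
      (g.abs_inn_le _ _).trans (mul_le_mul hk₀ (hkr j) (g.nrm_nonneg _) (by positivity))
    rw [hsplit]
    refine (abs_sub _ _).trans (add_le_add (hinn j) ?_)
    rw [abs_div, abs_two]
    gcongr
  have hmain := g.frakC_mul_nrm_le hd hs1 hsd hk (span_zc_image_le_span_range hMs hkM hk hp)
    (by positivity) (by positivity) hkr hβ
  have hbound := rpow_add_rpow_mul_pow_le (c := C * √(frakc g) ^ (-τ)) (D := D) hx (by positivity)
    (by positivity) hε0.le (hεδ.trans hδσ) hs1 hsd
  have hxyθ : x ^ θ ≤ 2 ^ θ * y ^ θ := by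
    rw [← Real.mul_rpow zero_le_two (by positivity)]
    gcongr
  refine le_trans ?_ (mul_le_mul_of_nonneg_right (le_max_right _ _) (by positivity))
  set L := (C * √(frakc g) ^ (-τ) + D / 2) * D ^ (s - 1)
  have hL : 0 ≤ L := by positivity
  calc g.nrm p ≤ s * s.factorial * (L * (2 ^ θ * y ^ θ)) / frakC g := by
        rw [le_div_iff₀' hF]
        refine hmain.trans (mul_le_mul_of_nonneg_left (hbound.trans ?_) (by positivity))
        gcongr
    _ = _ := by ring
end

section
/- Let 1 ≤ s ≤ d and let u₁,…,u_s be linearly independent vectors in ℝ^d. Let w ∈ span{u₁,…,u_s}, and suppose α, N > 0 are such that ‖u_j‖ ≤ N and |⟨w, u_j⟩| ≤ α for all j = 1,…,s. Then ‖w‖ ≤ s N^{s−1} α / Vol{u₁|⋯|u_s}. -/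
/-- **Hadamard's inequality**: the determinant is bounded by the product of the Euclidean norms of
the columns. -/
theorem Matrix.abs_det_le_prod_sqrt {n : ℕ} (A : Matrix (Fin n) (Fin n) ℝ) :
    |A.det| ≤ ∏ j, Real.sqrt (∑ i, A i j ^ 2) := by
  let b := EuclideanSpace.basisFun (Fin n) ℝ
  have : Fact (Module.finrank ℝ (EuclideanSpace ℝ (Fin n)) = n) := ⟨by simp⟩
  let v : Fin n → EuclideanSpace ℝ (Fin n) := fun j => WithLp.toLp 2 (A.col j)
  have hdet : b.toBasis.det v = A.det := by
    rw [Module.Basis.det_apply]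
    congr 1
  have h := b.toBasis.orientation.abs_volumeForm_apply_le v
  rw [b.toBasis.orientation.volumeForm_robust' b, hdet] at h
  simpa [v, EuclideanSpace.norm_eq] using h

namespace PDForm

variable {d : ℕ} (g : PDForm d)

theorem inn_sum_smul_sum_smul {s : ℕ} (u : Fin s → Fin d → ℝ) (a b : Fin s → ℝ) :
    g.inn (∑ i, a i • u i) (∑ i, b i • u i) =
      a ⬝ᵥ (Matrix.of fun i j => g.inn (u i) (u j)).mulVec b := by
  simp only [inn, map_sum, map_smul, LinearMap.sum_apply, LinearMap.smul_apply, smul_eq_mul,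
    dotProduct, Matrix.mulVec, Matrix.of_apply, Finset.mul_sum]
  rw [Finset.sum_comm]
  exact Finset.sum_congr rfl fun i _ => Finset.sum_congr rfl fun j _ => by ring

theorem posDef_of_linearIndependent {s : ℕ} {u : Fin s → Fin d → ℝ}
    (hind : LinearIndependent ℝ u) :
    (Matrix.of fun i j => g.inn (u i) (u j)).PosDef := by
  refine Matrix.PosDef.of_dotProduct_mulVec_pos (Matrix.IsHermitian.ext fun i j => ?_)
    fun x hx => ?_
  · simpa [inn] using g.symm (u j) (u i)
  · rw [star_trivial, ← inn_sum_smul_sum_smul]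
    refine g.posdef _ fun h => hx ?_
    exact funext (Fintype.linearIndependent_iff.mp hind x h)

open scoped MatrixOrder Matrix.Norms.L2Operator in
/-- The `j`-th coefficient of `w = ∑ c i • u i` is bounded by `‖w‖ N^{s-1} / Vol u`. -/
theorem abs_coeff_mul_gvol_le {s : ℕ} {u : Fin s → Fin d → ℝ} (hind : LinearIndependent ℝ u)
    {N : ℝ} (hu : ∀ j, g.nrm (u j) ≤ N) (c : Fin s → ℝ) (j : Fin s) :
    |c j| * gvol g u ≤ g.nrm (∑ i, c i • u i) * N ^ (s - 1) := by
  classical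
  obtain ⟨A, hA⟩ := CStarAlgebra.nonneg_iff_eq_star_mul_self.mp
    (g.posDef_of_linearIndependent hind).posSemidef.nonneg
  rw [Matrix.star_eq_conjTranspose, Matrix.conjTranspose_eq_transpose_of_trivial] at hA
  have hvol : gvol g u = |A.det| := by
    rw [gvol, hA, Matrix.det_mul, Matrix.det_transpose, Real.sqrt_mul_self_eq_abs]
  have hcol (i : Fin s) : Real.sqrt (∑ k, A k i ^ 2) = g.nrm (u i) := by
    have := congrFun (congrFun hA i) i
    rw [Matrix.of_apply, Matrix.mul_apply] at this
    rw [nrm, this]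
    simp only [Matrix.transpose_apply, sq]
  have hw : Real.sqrt (∑ k, (∑ i, c i • A k i) ^ 2) = g.nrm (∑ i, c i • u i) := by
    rw [nrm, inn_sum_smul_sum_smul, hA, ← Matrix.mulVec_mulVec, Matrix.dotProduct_mulVec,
      Matrix.vecMul_transpose]
    simp only [dotProduct, Matrix.mulVec, sq, smul_eq_mul, mul_comm (c _)]
  have h := Matrix.abs_det_le_prod_sqrt (A.updateCol j fun k => ∑ i, c i • A k i)
  rw [Matrix.det_updateCol_sum, smul_eq_mul, abs_mul, ← hvol,
    ← Finset.mul_prod_erase _ _ (Finset.mem_univ j)] at h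
  simp only [Matrix.updateCol_self, hw] at h
  refine h.trans (mul_le_mul_of_nonneg_left ?_ (Real.sqrt_nonneg _))
  calc _ ≤ ∏ _i ∈ Finset.univ.erase j, N := by
        refine Finset.prod_le_prod (fun _ _ => Real.sqrt_nonneg _) fun i hi => ?_
        simpa only [Matrix.updateCol_ne (Finset.ne_of_mem_erase hi), hcol] using hu i
    _ = N ^ (s - 1) := by simp

end PDForm

/-- If `u₁,…,u_s` are linearly independent, `w ∈ span{u₁,…,u_s}`,
`‖u_j‖ ≤ N` and `|⟨w,u_j⟩| ≤ α` for all `j`, then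
`‖w‖ ≤ s N^{s-1} α / Vol{u₁|⋯|u_s}`. -/
theorem statement13 {d : ℕ} (g : PDForm d) (s : ℕ) (hs1 : 1 ≤ s) (hsd : s ≤ d)
    (u : Fin s → (Fin d → ℝ)) (hind : LinearIndependent ℝ u)
    (w : Fin d → ℝ) (hw : w ∈ Submodule.span ℝ (Set.range u))
    (α N : ℝ) (hα : 0 < α) (hN : 0 < N)
    (hu : ∀ j, g.nrm (u j) ≤ N) (hwu : ∀ j, |g.inn w (u j)| ≤ α) :
    g.nrm w ≤ s * N ^ (s - 1) * α / gvol g u := by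
  obtain ⟨c, hc⟩ := (Submodule.mem_span_range_iff_exists_fun ℝ).mp hw
  have hvol : 0 < gvol g u := Real.sqrt_pos.mpr (g.posDef_of_linearIndependent hind).det_pos
  have hcoeff (j : Fin s) : |c j| * gvol g u ≤ g.nrm w * N ^ (s - 1) :=
    hc ▸ g.abs_coeff_mul_gvol_le hind hu c j
  have hnonneg : 0 ≤ g.inn w w := by
    rcases eq_or_ne w 0 with rfl | h
    · simp [PDForm.inn]
    · exact (g.posdef w h).le
  have hsq : g.nrm w * g.nrm w = ∑ j, c j * g.inn w (u j) := by
    rw [PDForm.nrm, Real.mul_self_sqrt hnonneg]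
    calc g.inn w w = g.inn w (∑ j, c j • u j) := by rw [hc]
      _ = ∑ j, c j * g.inn w (u j) := by simp [PDForm.inn]
  have hbound : g.nrm w * (g.nrm w * gvol g u) ≤ g.nrm w * (s * N ^ (s - 1) * α) := by
    calc g.nrm w * (g.nrm w * gvol g u) = ∑ j, c j * g.inn w (u j) * gvol g u := by
          rw [← mul_assoc, hsq, Finset.sum_mul]
      _ ≤ ∑ _j : Fin s, g.nrm w * N ^ (s - 1) * α := by
          refine Finset.sum_le_sum fun j _ => ?_
          calc c j * g.inn w (u j) * gvol g u ≤ |c j * g.inn w (u j)| * gvol g u := by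
                gcongr; exact le_abs_self _
            _ = |c j| * gvol g u * |g.inn w (u j)| := by rw [abs_mul]; ring
            _ ≤ g.nrm w * N ^ (s - 1) * α :=
                mul_le_mul (hcoeff j) (hwu j) (abs_nonneg _)
                  (mul_nonneg (Real.sqrt_nonneg _) (by positivity))
      _ = g.nrm w * (s * N ^ (s - 1) * α) := by simp; ring
  rw [le_div_iff₀ hvol]
  have hnrm : 0 ≤ g.nrm w := Real.sqrt_nonneg _
  rcases hnrm.eq_or_lt with h | h
  · rw [← h, zero_mul]
    positivity
  · exact le_of_mul_le_mul_left hbound h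
end

section
/- (One-dimensional resonant frequencies are bounded; quantitative core of the lemma that in dimension one operators in resonant normal form are smoothing.) Let g > 0 define on ℝ the inner product ⟨x,y⟩ := g·x·y, the norm ‖x‖ := √g·|x|, and the bracket ⟨x⟩ := (1+g x²)^{1/2}. Let δ ∈ (0,1), τ ≥ 0 and κ ∈ ℝ. Then there exists a constant C > 0, depending only on g, δ and τ, such that for every ξ ∈ ℝ and every k ∈ ℤ with k ≠ 0, if |⟨ξ+κ, k⟩| ≤ ⟨ξ+κ⟩^δ ‖k‖^{−τ} then ‖ξ+κ‖ ≤ C. -/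
/-- A nonnegative real `y` with `s * y ≤ (1 + y ^ 2) ^ (δ / 2) * B`, where `δ < 1`, is bounded in
terms of `s`, `B` and `δ`. -/
lemma le_max_of_mul_le_one_add_sq_rpow {s B δ y : ℝ} (hs : 0 < s) (hB : 0 ≤ B) (hδ0 : 0 ≤ δ)
    (hδ1 : δ < 1) (h : s * y ≤ (1 + y ^ 2) ^ (δ / 2) * B) :
    y ≤ max 1 ((2 ^ (δ / 2) * B / s) ^ (1 - δ)⁻¹) := by
  rcases le_total y 1 with hy | hy
  · exact le_max_of_le_left hy
  have hy0 : 0 < y := by linarith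
  have hbracket : (1 + y ^ 2) ^ (δ / 2) ≤ 2 ^ (δ / 2) * y ^ δ := by
    calc (1 + y ^ 2) ^ (δ / 2) ≤ (2 * y ^ 2) ^ (δ / 2) :=
          Real.rpow_le_rpow (by positivity) (by nlinarith) (by linarith)
      _ = 2 ^ (δ / 2) * y ^ δ := by
          rw [Real.mul_rpow (by norm_num) (by positivity), ← Real.rpow_natCast y 2,
            ← Real.rpow_mul hy0.le]
          congr 2
          push_cast
          ring
  refine le_max_of_le_right ?_
  rw [Real.le_rpow_inv_iff_of_pos hy0.le (by positivity) (by linarith),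
    Real.rpow_sub hy0, Real.rpow_one, div_le_div_iff₀ (by positivity) hs]
  calc y * s = s * y := mul_comm _ _
    _ ≤ 2 ^ (δ / 2) * y ^ δ * B := h.trans (by gcongr)
    _ = 2 ^ (δ / 2) * B * y ^ δ := by ring

/-- one-dimensional resonant frequencies are bounded. On `ℝ` with the
metric `g > 0` there is `C > 0`, depending only on `g, δ, τ`, such that for every `ξ ∈ ℝ`
and every nonzero `k ∈ ℤ`, the resonance condition
`|⟨ξ+κ,k⟩| ≤ ⟨ξ+κ⟩^δ ‖k‖^{-τ}` forces `‖ξ+κ‖ ≤ C`. -/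
theorem statement17 (g : ℝ) (hg : 0 < g) (δ τ : ℝ) (hδ0 : 0 < δ) (hδ1 : δ < 1)
    (hτ : 0 ≤ τ) :
    ∃ C : ℝ, 0 < C ∧ ∀ (κ ξ : ℝ) (k : ℤ), k ≠ 0 →
      |g * (ξ + κ) * (k : ℝ)| ≤
        (1 + g * (ξ + κ) ^ 2) ^ (δ / 2) * (Real.sqrt g * |(k : ℝ)|) ^ (-τ) →
      Real.sqrt g * |ξ + κ| ≤ C := by
  have hs : 0 < √g := Real.sqrt_pos.2 hg
  have hsq : √g ^ 2 = g := Real.sq_sqrt hg.le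
  refine ⟨max 1 ((2 ^ (δ / 2) * √g ^ (-τ) / √g) ^ (1 - δ)⁻¹), by positivity, ?_⟩
  intro κ ξ k hk h
  have hk1 : (1 : ℝ) ≤ |(k : ℝ)| := mod_cast Int.one_le_abs hk
  refine le_max_of_mul_le_one_add_sq_rpow hs (by positivity) hδ0.le hδ1 ?_
  calc √g * (√g * |ξ + κ|) = g * |ξ + κ| := by rw [← mul_assoc, ← sq, hsq]
    _ ≤ g * |ξ + κ| * |(k : ℝ)| := le_mul_of_one_le_right (by positivity) hk1
    _ = |g * (ξ + κ) * (k : ℝ)| := by rw [abs_mul, abs_mul, abs_of_pos hg]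
    _ ≤ (1 + g * (ξ + κ) ^ 2) ^ (δ / 2) * (√g * |(k : ℝ)|) ^ (-τ) := h
    _ ≤ (1 + g * (ξ + κ) ^ 2) ^ (δ / 2) * √g ^ (-τ) := by
        refine mul_le_mul_of_nonneg_left ?_ (by positivity)
        exact Real.rpow_le_rpow_of_nonpos hs (le_mul_of_one_le_right hs.le hk1) (by linarith)
    _ = (1 + (√g * |ξ + κ|) ^ 2) ^ (δ / 2) * √g ^ (-τ) := by rw [mul_pow, hsq, sq_abs]
end
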